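/- arXiv:2209.08013 — 3 statements merged into one kernel-verified Lean document; each statement's English description precedes it below -/
import Mathlib

section
/- Let X be a semigroup, e and f idempotents of X, x ∈ H_e and y ∈ H_f. If xy = yx, then ef = fe, xy ∈ H_{ef}, and the inverse of xy in the group H_{ef} satisfies (xy)⁻¹ = y⁻¹x⁻¹ = x⁻¹y⁻¹, where x⁻¹ and y⁻¹ are the inverses of x and y in the groups H_e and H_f respectively. -/
namespace CCS

universe u v

/-- A topological space is zero-dimensional if its topology has a base of clopen sets. -/
def ZeroDimensional (Y : Type v) [TopologicalSpace Y] : Prop :=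
  ∀ (y : Y), ∀ U ∈ nhds y, ∃ V : Set Y, IsClopen V ∧ y ∈ V ∧ V ⊆ U

/-- The class `T₁S` of topological semigroups with `T₁` underlying space
(as a property of the underlying topological space). -/
def ClassT1S (Y : Type v) [TopologicalSpace Y] : Prop := T1Space Y

/-- The class `T₂S` of Hausdorff topological semigroups. -/
def ClassT2S (Y : Type v) [TopologicalSpace Y] : Prop := T2Space Y

/-- The class `TzS` of Tychonoff (= completely regular `T₁`) zero-dimensional
topological semigroups. -/
def ClassTzS (Y : Type v) [TopologicalSpace Y] : Prop :=
  CompletelyRegularSpace Y ∧ T1Space Y ∧ ZeroDimensional Y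

/-- A semigroup `X` (with the discrete topology) is `C`-closed if for every topological
semigroup `Y` in the class `C` and every injective homomorphism `h : X → Y` whose image is a
discrete subspace of `Y` (equivalently, every isomorphic topological embedding of discrete `X`),
the image of `h` is closed in `Y`. -/
def IsCClosed (C : (Y : Type v) → [TopologicalSpace Y] → Prop)
    (X : Type u) [Semigroup X] : Prop :=
  ∀ (Y : Type v) [TopologicalSpace Y] [Semigroup Y] [ContinuousMul Y], C Y →
    ∀ h : X →ₙ* Y, Function.Injective h → DiscreteTopology (Set.range h) →
      IsClosed (Set.range h)

/-- A semigroup `X` is injectively `C`-closed if every injective homomorphism to a topological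
semigroup in the class `C` has closed image. -/
def IsInjectivelyCClosed (C : (Y : Type v) → [TopologicalSpace Y] → Prop)
    (X : Type u) [Semigroup X] : Prop :=
  ∀ (Y : Type v) [TopologicalSpace Y] [Semigroup Y] [ContinuousMul Y], C Y →
    ∀ h : X →ₙ* Y, Function.Injective h → IsClosed (Set.range h)

/-- A semigroup `X` is absolutely `C`-closed if every homomorphism to a topological
semigroup in the class `C` has closed image. -/
def IsAbsolutelyCClosed (C : (Y : Type v) → [TopologicalSpace Y] → Prop)
    (X : Type u) [Semigroup X] : Prop :=
  ∀ (Y : Type v) [TopologicalSpace Y] [Semigroup Y] [ContinuousMul Y], C Y →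
    ∀ h : X →ₙ* Y, IsClosed (Set.range h)

/-- A semigroup `X` is `C`-discrete if every injective homomorphism to a topological
semigroup in the class `C` has discrete image. -/
def IsCDiscrete (C : (Y : Type v) → [TopologicalSpace Y] → Prop)
    (X : Type u) [Semigroup X] : Prop :=
  ∀ (Y : Type v) [TopologicalSpace Y] [Semigroup Y] [ContinuousMul Y], C Y →
    ∀ h : X →ₙ* Y, Function.Injective h → DiscreteTopology (Set.range h)

variable {X : Type u}

/-- `I` is an ideal of the semigroup `X`: `IX ∪ XI ⊆ I`. -/
def IsIdeal [Semigroup X] (I : Set X) : Prop :=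
  ∀ i ∈ I, ∀ x : X, x * i ∈ I ∧ i * x ∈ I

/-- The Rees congruence `(I × I) ∪ {(x,x) : x ∈ X}` of an ideal `I`. -/
def reesCon [Semigroup X] (I : Set X) (hI : IsIdeal I) : Con X where
  r a b := a = b ∨ (a ∈ I ∧ b ∈ I)
  iseqv :=
    { refl := fun _ => Or.inl rfl
      symm := fun h => h.elim (fun h => Or.inl h.symm) (fun h => Or.inr ⟨h.2, h.1⟩)
      trans := fun h1 h2 => by
        rcases h1 with rfl | h1
        · exact h2
        · rcases h2 with rfl | h2
          · exact Or.inr h1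
          · exact Or.inr ⟨h1.1, h2.2⟩ }
  mul' := by
    rintro w x y z (rfl | ⟨hw, hx⟩) (rfl | ⟨hy, hz⟩)
    · exact Or.inl rfl
    · exact Or.inr ⟨(hI y hy w).1, (hI z hz w).1⟩
    · exact Or.inr ⟨(hI w hw y).2, (hI x hx y).2⟩
    · exact Or.inr ⟨(hI w hw y).2, (hI x hx z).2⟩

/-- A semigroup `X` is ideally `C`-closed if for every ideal `I ⊆ X` the Rees quotient
semigroup `X/I` is `C`-closed. (For `I = ∅` the Rees congruence is equality, so `X/∅ ≅ X`.) -/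
def IsIdeallyCClosed (C : (Y : Type v) → [TopologicalSpace Y] → Prop)
    (X : Type u) [Semigroup X] : Prop :=
  ∀ (I : Set X) (hI : IsIdeal I), IsCClosed C (reesCon I hI).Quotient

/-- A semigroup `X` is projectively `C`-closed if for every congruence `c` on `X` the
quotient semigroup `X/c` is `C`-closed. -/
def IsProjectivelyCClosed (C : (Y : Type v) → [TopologicalSpace Y] → Prop)
    (X : Type u) [Semigroup X] : Prop :=
  ∀ c : Con X, IsCClosed C c.Quotient

/-- `spow x n` is the power `x^(n+1)` of an element `x` of a semigroup. -/
def spow [Semigroup X] (x : X) : ℕ → X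
  | 0 => x
  | n + 1 => spow x n * x

/-- The center `Z(X) = {z ∈ X : ∀ x, xz = zx}` of a semigroup, as a set. -/
def centerSet (X : Type u) [Semigroup X] : Set X := {z | ∀ x : X, x * z = z * x}

/-- The center of a semigroup, as a subsemigroup. -/
def centerSub (X : Type u) [Semigroup X] : Subsemigroup X where
  carrier := centerSet X
  mul_mem' := by
    intro a b ha hb x
    rw [← mul_assoc, ha x, mul_assoc, hb x, ← mul_assoc]

/-- The ideal center `IZ(X) = {z ∈ Z(X) : zX ⊆ Z(X)}` of a semigroup, as a set. -/
def idealCenterSet (X : Type u) [Semigroup X] : Set X :=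
  {z | z ∈ centerSet X ∧ ∀ x : X, z * x ∈ centerSet X}

/-- The ideal center of a semigroup, as a subsemigroup. -/
def idealCenterSub (X : Type u) [Semigroup X] : Subsemigroup X where
  carrier := idealCenterSet X
  mul_mem' := by
    rintro a b ⟨ha, _⟩ ⟨hb, hb'⟩
    refine ⟨(centerSub X).mul_mem ha hb, fun x => ?_⟩
    rw [mul_assoc]
    exact (centerSub X).mul_mem ha (hb' x)

/-- The maximal subgroup `H_e` of a semigroup `X` containing an idempotent `e`
(which coincides with the `H`-class of `e`), as a subsemigroup of `X`:
it consists of all `x` with `xe = ex = x` possessing an inverse relative to `e`. -/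
def maxSubgroup (X : Type u) [Semigroup X] (e : X) : Subsemigroup X where
  carrier := {x | x * e = x ∧ e * x = x ∧
    ∃ y, y * e = y ∧ e * y = y ∧ x * y = e ∧ y * x = e}
  mul_mem' := by
    rintro a b ⟨hae, hea, y, hye, hey, hay, hya⟩ ⟨hbe, heb, z, hze, hez, hbz, hzb⟩
    refine ⟨?_, ?_, z * y, ?_, ?_, ?_, ?_⟩
    · rw [mul_assoc, hbe]
    · rw [← mul_assoc, hea]
    · rw [mul_assoc, hye]
    · rw [← mul_assoc, hez]
    · rw [mul_assoc, ← mul_assoc b z y, hbz, hey, hay]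
    · rw [mul_assoc, ← mul_assoc y a b, hya, heb, hzb]

/-- The set `H_e/e := {x ∈ X : xe = ex ∈ H_e}` associated with an idempotent `e`. -/
def heFraction [Semigroup X] (e : X) : Set X :=
  {x | x * e = e * x ∧ x * e ∈ maxSubgroup X e}

/-- An idempotent `e` is viable if `X \ (H_e/e)` is an ideal of `X`. -/
def IsViableIdem [Semigroup X] (e : X) : Prop :=
  IsIdeal {x | x ∉ heFraction e}

/-- `VE(X)`: the set of viable idempotents of `X`. -/
def viableIdems (X : Type u) [Semigroup X] : Set X :=
  {e | IsIdempotentElem e ∧ IsViableIdem e}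

/-- The Clifford part `H(X) = ⋃ {H_e : e ∈ E(X)}`: the union of all subgroups of `X`. -/
def cliffordPart (X : Type u) [Semigroup X] : Set X :=
  {x | ∃ e : X, IsIdempotentElem e ∧ x ∈ maxSubgroup X e}

/-- `∜A = {x ∈ X : xⁿ ∈ A for some n ≥ 1}`. -/
def roots [Semigroup X] (A : Set X) : Set X := {x | ∃ n : ℕ, spow x n ∈ A}

/-- A subset `G` of a semigroup `X` is a subgroup of `X` if it is a subsemigroup
which is a group. -/
def IsSubgroupSet [Semigroup X] (G : Set X) : Prop :=
  (∀ x ∈ G, ∀ y ∈ G, x * y ∈ G) ∧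
  ∃ e ∈ G, (∀ x ∈ G, x * e = x ∧ e * x = x) ∧
    (∀ x ∈ G, ∃ y ∈ G, x * y = e ∧ y * x = e)

/-- A subset of a semigroup is bounded if there is `n ≥ 1` such that the `n`-th power of
each of its elements is an idempotent. (For a group this means `gⁿ = e` for all `g`.) -/
def BoundedSet [Semigroup X] (S : Set X) : Prop :=
  ∃ n : ℕ, ∀ x ∈ S, IsIdempotentElem (spow x n)

/-- Every subgroup contained in `S` is finite. -/
def GroupFiniteSet [Semigroup X] (S : Set X) : Prop :=
  ∀ G : Set X, G ⊆ S → IsSubgroupSet G → G.Finite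

/-- Every subgroup contained in `S` is bounded. -/
def GroupBoundedSet [Semigroup X] (S : Set X) : Prop :=
  ∀ G : Set X, G ⊆ S → IsSubgroupSet G → BoundedSet G

/-- A semigroup is chain-finite if every infinite subset `I` contains `x, y`
with `xy ∉ {x, y}`. -/
def ChainFinite (X : Type u) [Semigroup X] : Prop :=
  ∀ I : Set X, I.Infinite → ∃ x ∈ I, ∃ y ∈ I, x * y ∉ ({x, y} : Set X)

/-- A semigroup is periodic if some power (with exponent `≥ 1`) of every element
is an idempotent. -/
def Periodic (X : Type u) [Semigroup X] : Prop :=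
  ∀ x : X, ∃ n : ℕ, IsIdempotentElem (spow x n)

/-- A semigroup is nonsingular if there is no infinite `A ⊆ X` with `AA` a singleton. -/
def Nonsingular (X : Type u) [Semigroup X] : Prop :=
  ¬ ∃ A : Set X, A.Infinite ∧ ∃ a : X, ∀ x ∈ A, ∀ y ∈ A, x * y = a

/-- A semigroup is group-finite if each of its subgroups is finite. -/
def GroupFinite (X : Type u) [Semigroup X] : Prop :=
  ∀ G : Set X, IsSubgroupSet G → G.Finite

/-- A semigroup is group-bounded if each of its subgroups is bounded. -/
def GroupBounded (X : Type u) [Semigroup X] : Prop :=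
  ∀ G : Set X, IsSubgroupSet G → BoundedSet G

/-- A semigroup is Clifford+finite if `X \ H(X)` is finite. -/
def CliffordFinite (X : Type u) [Semigroup X] : Prop :=
  Set.Finite {x : X | x ∉ cliffordPart X}

/-- A subset `S` of a semigroup is periodic. -/
def PeriodicSet [Semigroup X] (S : Set X) : Prop :=
  ∀ x ∈ S, ∃ n : ℕ, IsIdempotentElem (spow x n)

/-- A subset `S` of a semigroup is nonsingular. -/
def NonsingularSet [Semigroup X] (S : Set X) : Prop :=
  ¬ ∃ A : Set X, A ⊆ S ∧ A.Infinite ∧ ∃ a : X, ∀ x ∈ A, ∀ y ∈ A, x * y = a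

/-- If `xi` is the inverse of `x` in the maximal subgroup at `e`, then every element commuting
with `x` commutes with `xi`. -/
theorem commute_of_inverse_of_commute [Semigroup X] {e x xi z : X}
    (hxe : x * e = x) (hex : e * x = x) (hxie : xi * e = xi) (hexi : e * xi = xi)
    (hxxi : x * xi = e) (hxix : xi * x = e) (h : Commute x z) : Commute xi z := by
  have hr : e * z * e = e * z := by
    rw [← hxix, mul_assoc xi x z, h.eq, hxix, mul_assoc, mul_assoc, hxe]
  have hl : e * z * e = z * e := by
    have hze : z * e = x * (z * xi) := by rw [← hxxi, ← mul_assoc, ← h.eq, mul_assoc]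
    rw [mul_assoc, hze, ← mul_assoc, hex]
  have hc : e * z = z * e := hr.symm.trans hl
  calc xi * z = xi * (e * z) := by rw [← mul_assoc, hxie]
    _ = xi * (z * (x * xi)) := by rw [hc, hxxi]
    _ = xi * (x * z) * xi := by rw [h.eq]; simp only [mul_assoc]
    _ = e * z * xi := by rw [← mul_assoc, hxix]
    _ = z * xi := by rw [hc, mul_assoc, hexi]

/-- Let `e, f` be idempotents of a semigroup `X`, `x ∈ H_e` with inverse `xi` and
`y ∈ H_f` with inverse `yi`. If `xy = yx`, then `ef = fe`, `xy ∈ H_{ef}`, and the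
inverse of `xy` in the group `H_{ef}` is `yi * xi = xi * yi`. -/
theorem mul_mem_maxSubgroup_of_commute (X : Type u) [Semigroup X] (e f x y xi yi : X)
    (he : IsIdempotentElem e) (hf : IsIdempotentElem f)
    (hxe : x * e = x) (hex : e * x = x)
    (hxie : xi * e = xi) (hexi : e * xi = xi)
    (hxxi : x * xi = e) (hxix : xi * x = e)
    (hyf : y * f = y) (hfy : f * y = y)
    (hyif : yi * f = yi) (hfyi : f * yi = yi)
    (hyyi : y * yi = f) (hyiy : yi * y = f)
    (hcomm : x * y = y * x) :
    e * f = f * e ∧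
    x * y ∈ maxSubgroup X (e * f) ∧
    yi * xi ∈ maxSubgroup X (e * f) ∧
    (x * y) * (yi * xi) = e * f ∧ (yi * xi) * (x * y) = e * f ∧
    yi * xi = xi * yi := by
  have hxiy : Commute xi y :=
    commute_of_inverse_of_commute hxe hex hxie hexi hxxi hxix hcomm
  have hyix : Commute yi x :=
    commute_of_inverse_of_commute hyf hfy hyif hfyi hyyi hyiy hcomm.symm
  have hyixi : Commute yi xi :=
    commute_of_inverse_of_commute hyf hfy hyif hfyi hyyi hyiy hxiy.symm
  have hey : Commute e y := hxxi ▸ Commute.mul_left hcomm hxiy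
  have heyi : Commute e yi := hxxi ▸ Commute.mul_left hyix.symm hyixi.symm
  have hef : Commute e f := hyyi ▸ hey.mul_right heyi
  have hfx : Commute f x := hyyi ▸ Commute.mul_left hcomm.symm hyix
  have hfxi : Commute f xi := hyyi ▸ Commute.mul_left hxiy.symm hyixi
  have hxy_right : x * y * (e * f) = x * y := by
    rw [← mul_assoc, mul_assoc x y e, ← hey.eq, ← mul_assoc x e y, hxe, mul_assoc, hyf]
  have hxy_left : e * f * (x * y) = x * y := by
    rw [mul_assoc, ← mul_assoc f x y, hfx.eq, mul_assoc x f y, hfy, ← mul_assoc, hex]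
  have hinv_right : yi * xi * (e * f) = yi * xi := by
    rw [← mul_assoc, mul_assoc yi xi e, hxie, mul_assoc, ← hfxi.eq, ← mul_assoc, hyif]
  have hinv_left : e * f * (yi * xi) = yi * xi := by
    rw [mul_assoc, ← mul_assoc f yi xi, hfyi, ← mul_assoc, heyi.eq, mul_assoc, hexi]
  have hmul_inv : x * y * (yi * xi) = e * f := by
    rw [mul_assoc, ← mul_assoc y yi xi, hyyi, hfxi.eq, ← mul_assoc, hxxi]
  have hinv_mul : yi * xi * (x * y) = e * f := by
    rw [mul_assoc, ← mul_assoc xi x y, hxix, ← mul_assoc, ← heyi.eq, mul_assoc, hyiy]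
  exact ⟨hef.eq, ⟨hxy_right, hxy_left, yi * xi, hinv_right, hinv_left, hmul_inv, hinv_mul⟩,
    ⟨hinv_right, hinv_left, x * y, hxy_right, hxy_left, hinv_mul, hmul_inv⟩,
    hmul_inv, hinv_mul, hyixi.eq⟩

end CCS
end

section
/- Let X be a semigroup. Every idempotent e belonging to the ideal center IZ(X) is viable. -/
namespace CCS

universe u v

variable {X : Type u}

/-- For an idempotent `e` of the ideal center, `x ∈ H_e/e` if and only if `e` is a right multiple
of `ex`. -/
theorem mem_heFraction_iff_of_mem_idealCenter {X : Type u} [Semigroup X] {e : X}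
    (he : IsIdempotentElem e) (hz : e ∈ idealCenterSet X) (x : X) :
    x ∈ heFraction e ↔ ∃ w, e * (x * w) = e := by
  obtain ⟨hc, hi⟩ := hz
  constructor
  · rintro ⟨hx, -, -, y, -, -, hy, -⟩
    exact ⟨y, by rw [← mul_assoc, ← hx, hy]⟩
  · rintro ⟨w, hw⟩
    have hright : x * e * (e * w) = e := by
      rw [mul_assoc, ← mul_assoc e e w, he.eq, ← mul_assoc, hc x, mul_assoc, hw]
    refine ⟨hc x, ?_, ?_, e * w, ?_, ?_, hright, ?_⟩
    · rw [mul_assoc, he.eq]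
    · rw [hc x, ← mul_assoc, he.eq]
    · rw [hc, ← mul_assoc, he.eq]
    · rw [← mul_assoc, he.eq]
    · rw [← hi w, hright]

/-- Every idempotent `e` belonging to the ideal center `IZ(X)` of a semigroup `X`
is viable. -/
theorem viable_of_mem_idealCenter (X : Type u) [Semigroup X] (e : X)
    (he : IsIdempotentElem e) (hz : e ∈ idealCenterSet X) : IsViableIdem e := by
  intro i hni x
  have hiff := mem_heFraction_iff_of_mem_idealCenter he hz
  refine ⟨fun h => hni ?_, fun h => hni ?_⟩
  · obtain ⟨w, hw⟩ := (hiff _).1 h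
    refine (hiff i).2 ⟨w * x, ?_⟩
    rw [← mul_assoc i, ← mul_assoc e, ← hz.1, mul_assoc, hz.2 x, mul_assoc, ← mul_assoc x, hw]
  · obtain ⟨w, hw⟩ := (hiff _).1 h
    exact (hiff i).2 ⟨x * w, by rw [← mul_assoc i, hw]⟩

end CCS
end

section
/- Let X be a semigroup whose center Z(X) is periodic and nonsingular, let e be an idempotent belonging to the ideal center IZ(X), and assume that for every idempotent f ∈ IZ(X) with f < e the maximal subgroup H_f is a bounded group. Then for every a ∈ X \ (H_e/e), the set G_a = {x ∈ H_e : ax = ae} is a subgroup of the (commutative) group H_e and the quotient group H_e/G_a is bounded. -/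
namespace CCS

universe u v

variable {X : Type u}

/-- If `x ↦ x * b` sends the `N`-th powers of units to a finite set, then some fixed positive
power of every unit fixes `b`. -/
theorem exists_pow_units_mul_eq_of_finite {M : Type*} [CommMonoid M] (b : M) (N : ℕ)
    (hN : 0 < N) (hfin : (Set.range fun u : Mˣ => ((u ^ N : Mˣ) : M) * b).Finite) :
    ∃ K : ℕ, 0 < K ∧ ∀ u : Mˣ, ((u ^ K : Mˣ) : M) * b = b := by
  let P : Subgroup Mˣ := (powMonoidHom N : Mˣ →* Mˣ).range
  have horb : (MulAction.orbit P b).Finite := by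
    refine hfin.subset ?_
    rintro _ ⟨⟨_, u, rfl⟩, rfl⟩
    exact ⟨u, rfl⟩
  have hidx := MulAction.index_stabilizer P b
  refine ⟨N * (MulAction.stabilizer P b).index, Nat.mul_pos hN ?_, fun u => ?_⟩
  · rw [hidx]
    exact (Set.ncard_pos horb).2 (MulAction.nonempty_orbit b)
  · have h := Subgroup.pow_index_mem (MulAction.stabilizer P b) (⟨u ^ N, u, rfl⟩ : P)
    rw [pow_mul]
    exact h

/-- In a commutative monoid in which a set with a one-point square is finite, if units of a fixed
exponent act trivially on some positive power of `b`, then units of some exponent act trivially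
on `b` itself. -/
theorem exists_pow_units_mul_eq {M : Type*} [CommMonoid M]
    (hns : ∀ (A : Set M) (c : M), (∀ x ∈ A, ∀ y ∈ A, x * y = c) → A.Finite) (b : M) (n : ℕ)
    (h : ∃ N : ℕ, 0 < N ∧ ∀ u : Mˣ, ((u ^ N : Mˣ) : M) * b ^ (n + 1) = b ^ (n + 1)) :
    ∃ N : ℕ, 0 < N ∧ ∀ u : Mˣ, ((u ^ N : Mˣ) : M) * b = b := by
  induction n with
  | zero => simpa using h
  | succ n ih =>
    obtain ⟨N, hN, hfix⟩ := h
    refine ih (exists_pow_units_mul_eq_of_finite _ N hN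
      (hns _ (b ^ (n + 1) * b ^ (n + 1)) ?_))
    rintro _ ⟨u, rfl⟩ _ ⟨v, rfl⟩
    have hsq : b ^ (n + 1) * b ^ (n + 1) = b ^ (n + 1 + 1) * b ^ n := by
      rw [← pow_add, ← pow_add]
      congr 1
      omega
    dsimp only
    rw [mul_mul_mul_comm, ← Units.val_mul, ← mul_pow, hsq, ← mul_assoc, hfix]

/-- The commutative monoid `eX` attached to an idempotent `e` of the ideal center. -/
abbrev cornerCommMonoid [Semigroup X] {e : X} (he : IsIdempotentElem e)
    (heIZ : e ∈ idealCenterSet X) : CommMonoid {x : X // e * x = x} where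
  mul x y := ⟨x.1 * y.1, by rw [← mul_assoc, x.2]⟩
  mul_assoc x y z := Subtype.ext (mul_assoc x.1 y.1 z.1)
  one := ⟨e, he⟩
  one_mul x := Subtype.ext x.2
  mul_one x := Subtype.ext ((heIZ.1 x.1).trans x.2)
  mul_comm x y := Subtype.ext (by
    have hy := heIZ.2 y.1
    rw [y.2] at hy
    exact hy x.1)

section Corner

variable [Semigroup X] {e : X} (he : IsIdempotentElem e) (heIZ : e ∈ idealCenterSet X)

theorem coe_corner_pow_succ (x : {x : X // e * x = x}) (n : ℕ) :
    letI := cornerCommMonoid he heIZ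
    (x ^ (n + 1)).1 = spow x.1 n := by
  let _ := cornerCommMonoid he heIZ
  induction n with
  | zero => simp [spow]
  | succ n ih =>
    rw [pow_succ, spow, ← ih]
    rfl

theorem mem_maxSubgroup_iff_isUnit_corner (x : {x : X // e * x = x}) :
    letI := cornerCommMonoid he heIZ
    x.1 ∈ maxSubgroup X e ↔ IsUnit x := by
  let _ := cornerCommMonoid he heIZ
  constructor
  · rintro ⟨-, -, y, -, hey, hxy, -⟩
    exact IsUnit.of_mul_eq_one ⟨y, hey⟩ (Subtype.ext hxy)
  · rintro ⟨u, rfl⟩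
    exact ⟨(heIZ.1 _).trans u.1.2, u.1.2, (u⁻¹).1.1, (heIZ.1 _).trans (u⁻¹).1.2,
      (u⁻¹).1.2, congrArg Subtype.val u.mul_inv, congrArg Subtype.val u.inv_mul⟩

end Corner

/-- Let `X` be a semigroup whose center is periodic and nonsingular, let `e` be an
idempotent of the ideal center `IZ(X)` such that for every idempotent `f ∈ IZ(X)` with
`f < e` the maximal subgroup `H_f` is a bounded group. Then for every `a ∈ X \ (H_e/e)`
the set `G_a = {x ∈ H_e : ax = ae}` is a subgroup of `H_e` and the quotient group
`H_e/G_a` is bounded (there is `n ≥ 1` with `xⁿ ∈ G_a` for all `x ∈ H_e`). -/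
theorem quotient_by_Ga_bounded (X : Type u) [Semigroup X]
    (hper : PeriodicSet (centerSet X)) (hns : NonsingularSet (centerSet X))
    (e : X) (he : IsIdempotentElem e) (heIZ : e ∈ idealCenterSet X)
    (hmin : ∀ f : X, IsIdempotentElem f → f ∈ idealCenterSet X →
      e * f = f → f * e = f → f ≠ e →
      ∃ n : ℕ, ∀ g ∈ maxSubgroup X f, spow g n = f)
    (a : X) (ha : a ∉ heFraction e) :
    IsSubgroupSet {x : X | x ∈ maxSubgroup X e ∧ a * x = a * e} ∧
    ∃ n : ℕ, ∀ x ∈ maxSubgroup X e,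
      spow x n ∈ {g : X | g ∈ maxSubgroup X e ∧ a * g = a * e} := by
  let _ := cornerCommMonoid he heIZ
  have hcen : ∀ x : {x : X // e * x = x}, x.1 ∈ centerSet X := fun x => by
    have h := heIZ.2 x.1
    rwa [x.2] at h
  have hea : e * (e * a) = e * a := by rw [← mul_assoc, he.eq]
  have hae : a * e = e * a := heIZ.1 a
  have hmul : ∀ x : {x : X // e * x = x}, a * x.1 = x.1 * (e * a) := fun x => by
    rw [hcen x a, ← mul_assoc, heIZ.1 x.1, x.2]
  let b : {x : X // e * x = x} := ⟨e * a, hea⟩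
  have hGa : ∀ x : {x : X // e * x = x}, a * x.1 = a * e ↔ x * b = b := fun x => by
    rw [hmul, hae, Subtype.ext_iff]
    rfl
  have hunit : ∀ x ∈ maxSubgroup X e,
      ∃ u : {x : X // e * x = x}ˣ, u.1.1 = x := fun x hx => by
    obtain ⟨u, hu⟩ := (mem_maxSubgroup_iff_isUnit_corner he heIZ ⟨x, hx.2.1⟩).1 hx
    exact ⟨u, congrArg Subtype.val hu⟩
  have hmem : ∀ u : {x : X // e * x = x}ˣ, u.1.1 ∈ maxSubgroup X e := fun u =>
    (mem_maxSubgroup_iff_isUnit_corner he heIZ u.1).2 u.isUnit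
  refine ⟨⟨?_, e, ⟨hmem 1, rfl⟩, fun x hx => ⟨hx.1.1, hx.1.2.1⟩, ?_⟩, ?_⟩
  · rintro x ⟨hx, hax⟩ y ⟨hy, hay⟩
    refine ⟨(maxSubgroup X e).mul_mem hx hy, ?_⟩
    rw [← mul_assoc, hax, mul_assoc, hy.2.1, hay]
  · rintro x ⟨hx, hax⟩
    obtain ⟨u, rfl⟩ := hunit x hx
    refine ⟨(u⁻¹).1.1, ⟨hmem _, (hGa _).2 ?_⟩, congrArg Subtype.val u.mul_inv,
      congrArg Subtype.val u.inv_mul⟩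
    rw [Units.inv_mul_eq_iff_eq_mul]
    exact ((hGa _).1 hax).symm
  · obtain ⟨n, hn⟩ := hper b.1 (hcen b)
    rw [← coe_corner_pow_succ he heIZ] at hn
    set f := b ^ (n + 1) with hf
    have hff : f * f = f := Subtype.ext hn
    have hfe : f.1 ≠ e := fun h => by
      have h1 : f = 1 := Subtype.ext h
      refine ha ⟨hae, ?_⟩
      rw [hae]
      exact (mem_maxSubgroup_iff_isUnit_corner he heIZ b).2
        (IsUnit.of_pow_eq_one h1 n.succ_ne_zero)
    have hfIZ : f.1 ∈ idealCenterSet X :=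
      ⟨hcen f, fun x => hcen ⟨f.1 * x, by rw [← mul_assoc, f.2]⟩⟩
    obtain ⟨m, hm⟩ := hmin f.1 hn hfIZ f.2 ((heIZ.1 _).trans f.2) hfe
    have hfix : ∀ u : {x : X // e * x = x}ˣ,
        ((u ^ (m + 1) : {x : X // e * x = x}ˣ) : {x : X // e * x = x}) * f = f := fun u => by
      have hidem : ∀ k : ℕ, f ^ (k + 1) = f := fun k => IsIdempotentElem.pow_succ_eq k hff
      have hinv : ∀ v w : {x : X // e * x = x}, v * w = 1 → v * f * (w * f) = f :=
        fun v w h => by rw [mul_mul_mul_comm, h, hff, one_mul]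
      have hg : (u.1 * f).1 ∈ maxSubgroup X f.1 :=
        ⟨congrArg Subtype.val (show u.1 * f * f = u.1 * f by rw [mul_assoc, hff]),
          congrArg Subtype.val (show f * (u.1 * f) = u.1 * f by rw [mul_left_comm, hff]),
          ((u⁻¹).1 * f).1,
          congrArg Subtype.val (show (u⁻¹).1 * f * f = (u⁻¹).1 * f by rw [mul_assoc, hff]),
          congrArg Subtype.val
            (show f * ((u⁻¹).1 * f) = (u⁻¹).1 * f by rw [mul_left_comm, hff]),
          congrArg Subtype.val (hinv _ _ u.mul_inv),
          congrArg Subtype.val (hinv _ _ u.inv_mul)⟩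
      have hp := hm _ hg
      rw [← coe_corner_pow_succ he heIZ] at hp
      have hp' : (u.1 * f) ^ (m + 1) = f := Subtype.ext hp
      rwa [mul_pow, hidem, ← Units.val_pow_eq_pow_val] at hp'
    have hfinite : ∀ (A : Set {x : X // e * x = x}) (c : {x : X // e * x = x}),
        (∀ x ∈ A, ∀ y ∈ A, x * y = c) → A.Finite := fun A c hA => by
      by_contra hinf
      refine hns ⟨Subtype.val '' A, ?_, Set.Infinite.image Subtype.val_injective.injOn hinf,
        c.1, ?_⟩
      · rintro _ ⟨x, -, rfl⟩
        exact hcen x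
      · rintro _ ⟨x, hx, rfl⟩ _ ⟨y, hy, rfl⟩
        exact congrArg Subtype.val (hA x hx y hy)
    obtain ⟨N, hN, hNb⟩ := exists_pow_units_mul_eq hfinite b n ⟨m + 1, m.succ_pos, hfix⟩
    obtain ⟨k, rfl⟩ := Nat.exists_eq_succ_of_ne_zero hN.ne'
    refine ⟨k, fun x hx => ?_⟩
    obtain ⟨u, rfl⟩ := hunit x hx
    rw [← coe_corner_pow_succ he heIZ, ← Units.val_pow_eq_pow_val]
    exact ⟨hmem _, (hGa _).2 (hNb u)⟩

end CCS
end
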